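/- Let G be a finite connected simple graph of order n ≥ 3. Then γ_qtR(G) = n if and only if G is isomorphic to a path P_n or a cycle C_n (equivalently, G is connected with maximum degree at most two). -/

import Mathlib

/-- A Roman dominating function: labels in {0,1,2}, and every vertex labeled 0
has a neighbor labeled 2. -/
def IsRDF {V : Type*} (G : SimpleGraph V) (f : V → ℕ) : Prop :=
  (∀ v, f v ≤ 2) ∧ ∀ u, f u = 0 → ∃ v, G.Adj u v ∧ f v = 2

/-- A quasi-total Roman dominating function: an RDF such that every vertex labeled 2
has a neighbor with positive label. -/
def IsQTRDF {V : Type*} (G : SimpleGraph V) (f : V → ℕ) : Prop :=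
  IsRDF G f ∧ ∀ x, f x = 2 → ∃ y, G.Adj x y ∧ 1 ≤ f y

/-- A total Roman dominating function: an RDF such that every vertex with positive label
has a neighbor with positive label. -/
def IsTRDF {V : Type*} (G : SimpleGraph V) (f : V → ℕ) : Prop :=
  IsRDF G f ∧ ∀ v, 1 ≤ f v → ∃ w, G.Adj v w ∧ 1 ≤ f w

/-- The Roman domination number. -/
noncomputable def gammaR {V : Type*} [Fintype V] (G : SimpleGraph V) : ℕ :=
  sInf {w | ∃ f : V → ℕ, IsRDF G f ∧ ∑ v, f v = w}

/-- The quasi-total Roman domination number. -/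
noncomputable def gammaQTR {V : Type*} [Fintype V] (G : SimpleGraph V) : ℕ :=
  sInf {w | ∃ f : V → ℕ, IsQTRDF G f ∧ ∑ v, f v = w}

/-- The total Roman domination number. -/
noncomputable def gammaTR {V : Type*} [Fintype V] (G : SimpleGraph V) : ℕ :=
  sInf {w | ∃ f : V → ℕ, IsTRDF G f ∧ ∑ v, f v = w}

/-- A dominating set: every vertex outside it has a neighbor in it. -/
def IsDomSet {V : Type*} (G : SimpleGraph V) (D : Finset V) : Prop :=
  ∀ v ∉ D, ∃ u ∈ D, G.Adj v u

/-- The domination number. -/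
noncomputable def gammaDom {V : Type*} [Fintype V] (G : SimpleGraph V) : ℕ :=
  sInf {n | ∃ D : Finset V, IsDomSet G D ∧ D.card = n}

/-- A total dominating set: every vertex has a neighbor in it. -/
def IsTotalDomSet {V : Type*} (G : SimpleGraph V) (D : Finset V) : Prop :=
  ∀ v, ∃ u ∈ D, G.Adj v u

/-- The total domination number. -/
noncomputable def gammaT {V : Type*} [Fintype V] (G : SimpleGraph V) : ℕ :=
  sInf {n | ∃ D : Finset V, IsTotalDomSet G D ∧ D.card = n}

/-- A packing: a set of vertices whose closed neighborhoods are pairwise disjoint. -/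
def IsPacking {V : Type*} (G : SimpleGraph V) (B : Finset V) : Prop :=
  ∀ u ∈ B, ∀ v ∈ B, u ≠ v →
    ∀ w, ¬ ((w = u ∨ G.Adj u w) ∧ (w = v ∨ G.Adj v w))

/-- The packing number. -/
noncomputable def packingNumber {V : Type*} [Fintype V] (G : SimpleGraph V) : ℕ :=
  sSup {n | ∃ B : Finset V, IsPacking G B ∧ B.card = n}

section QuasiTotalRoman

variable {V : Type*}

theorem isQTRDF_one (G : SimpleGraph V) : IsQTRDF G (fun _ => 1) := by
  simp [IsQTRDF, IsRDF]

theorem gammaQTR_le_sum [Fintype V] {G : SimpleGraph V} {f : V → ℕ} (hf : IsQTRDF G f) :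
    gammaQTR G ≤ ∑ v, f v :=
  Nat.sInf_le ⟨f, hf, rfl⟩

theorem exists_isQTRDF_sum_eq_gammaQTR [Fintype V] (G : SimpleGraph V) :
    ∃ f : V → ℕ, IsQTRDF G f ∧ ∑ v, f v = gammaQTR G :=
  Nat.sInf_mem (s := {w | ∃ f : V → ℕ, IsQTRDF G f ∧ ∑ v, f v = w})
    ⟨_, _, isQTRDF_one G, rfl⟩

theorem gammaQTR_le_card [Fintype V] (G : SimpleGraph V) : gammaQTR G ≤ Fintype.card V := by
  simpa using gammaQTR_le_sum (isQTRDF_one G)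

theorem gammaQTR_lt_card_of_two_lt_degree [Fintype V] {G : SimpleGraph V} [DecidableRel G.Adj]
    {v : V} (hv : 2 < G.degree v) : gammaQTR G < Fintype.card V := by
  classical
  obtain ⟨a, b, c, ha, hb, hc, hab, hac, hbc⟩ := Finset.two_lt_card_iff.mp hv
  rw [SimpleGraph.mem_neighborFinset] at ha hb hc
  let f : V → ℕ := fun x => if x = v then 2 else if x = b ∨ x = c then 0 else 1
  have hf : IsQTRDF G f := by
    refine ⟨⟨fun x => ?_, fun u hu => ⟨v, ?_, by simp [f]⟩⟩, fun x hx => ⟨a, ?_, ?_⟩⟩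
    · dsimp only [f]; split_ifs <;> omega
    · have : u = b ∨ u = c := by
        dsimp only [f] at hu; split_ifs at hu; assumption
      rcases this with rfl | rfl
      exacts [hb.symm, hc.symm]
    · have : x = v := by
        dsimp only [f] at hx; split_ifs at hx <;> first | assumption | omega
      rwa [this]
    · simp [f, ha.ne', hab, hac]
  have hsum : ∑ x, (f x + ((if x = b then 1 else 0) + if x = c then 1 else 0)) =
      ∑ x, (1 + if x = v then 1 else 0) := by
    refine Finset.sum_congr rfl fun x _ => ?_
    have hvb := hb.ne
    have hvc := hc.ne
    dsimp only [f]
    split_ifs <;> grind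
  simp only [Finset.sum_add_distrib, Finset.sum_ite_eq', Finset.mem_univ, if_true,
    Finset.sum_const, Finset.card_univ, smul_eq_mul, mul_one] at hsum
  have := gammaQTR_le_sum hf
  omega

theorem IsQTRDF.card_zero_le_card_two [Fintype V] {G : SimpleGraph V} [DecidableRel G.Adj]
    {f : V → ℕ} (hf : IsQTRDF G f) (hG : G.maxDegree ≤ 2) :
    (Finset.univ.filter (f · = 0)).card ≤ (Finset.univ.filter (f · = 2)).card := by
  classical
  refine Finset.card_le_card_of_forall_subsingleton G.Adj (fun u hu => ?_) fun x hx u hu w hw => ?_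
  · obtain ⟨x, hux, hx⟩ := hf.1.2 u (by simpa using hu)
    exact ⟨x, by simpa using hx, hux⟩
  · obtain ⟨y, hxy, hy⟩ := hf.2 x (by simpa using hx)
    simp only [Finset.mem_filter, Finset.mem_univ, true_and, Set.mem_ofPred_eq] at hu hw
    by_contra huw
    have hdeg : 2 < G.degree x := Finset.two_lt_card_iff.mpr
      ⟨u, w, y, by simpa using hu.2.symm, by simpa using hw.2.symm, by simpa using hxy, huw,
        by rintro rfl; omega, by rintro rfl; omega⟩
    have := G.degree_le_maxDegree x
    omega

theorem IsQTRDF.card_le_sum [Fintype V] {G : SimpleGraph V} [DecidableRel G.Adj]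
    {f : V → ℕ} (hf : IsQTRDF G f) (hG : G.maxDegree ≤ 2) :
    Fintype.card V ≤ ∑ v, f v := by
  have hsum : ∑ v, (1 + if f v = 2 then 1 else 0) ≤ ∑ v, (f v + if f v = 0 then 1 else 0) :=
    Finset.sum_le_sum fun v _ => by split_ifs <;> omega
  simp only [Finset.sum_add_distrib, ← Finset.card_filter, Finset.sum_const, Finset.card_univ,
    smul_eq_mul, mul_one] at hsum
  have := hf.card_zero_le_card_two hG
  omega

end QuasiTotalRoman

theorem stmt15 {V : Type*} [Fintype V] (G : SimpleGraph V) [DecidableRel G.Adj]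
    (hconn : G.Connected) (hcard : 3 ≤ Fintype.card V) :
    gammaQTR G = Fintype.card V ↔ G.maxDegree ≤ 2 := by
  refine ⟨fun h => G.maxDegree_le_of_forall_degree_le 2 fun v => ?_,
    fun h => (gammaQTR_le_card G).antisymm ?_⟩
  · by_contra! hv
    exact (gammaQTR_lt_card_of_two_lt_degree hv).ne h
  · obtain ⟨f, hf, hsum⟩ := exists_isQTRDF_sum_eq_gammaQTR G
    exact hsum ▸ hf.card_le_sum h
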